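/- Let n > k ≥ 1 with gcd(n,k)=1 and let U be a UIO with n + k elements. Then the number of (n+k)-Eschers in U is at most the product of the number of n-Eschers and the number of k-Eschers in U: #P_{n+k}^U ≤ #P_n^U · #P_k^U. -/

import Mathlib

/-- An `m`-Escher in a UIO `U`, encoded as an `m`-periodic sequence. -/
def IsEscher (U : Finset ℝ) (m : ℕ) (w : ℕ → ℝ) : Prop :=
  (∀ i, w (i + m) = w i) ∧ (∀ i, w i ∈ U) ∧
  (∀ i j, i < m → j < m → w i = w j → i = j) ∧ (∀ i, w i < w (i + 1) + 1)

/-- Wrapping a window of length `m` into an Escher. -/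
lemma escher_wrap (U : Finset ℝ) (m a : ℕ) (hm : 0 < m) (g : ℕ → ℝ)
    (hU : ∀ r, g r ∈ U) (hinj : ∀ r s, r < m → s < m → g r = g s → r = s)
    (hstep : ∀ r, r + 1 < m → g r < g (r + 1) + 1) (hlast : g (m - 1) < g 0 + 1) :
    ∃ u, IsEscher U m u ∧ ∀ r, r < m → u (a + r) = g r := by
  refine ⟨fun j => g ((j + (m * a - a)) % m), ⟨?_, ?_, ?_, ?_⟩, ?_⟩
  · intro i
    have : i + m + (m * a - a) = i + (m * a - a) + m := by omega
    simp only [this, Nat.add_mod_right]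
  · intro i; exact hU _
  · intro i j hi hj h
    have h1 := hinj _ _ (Nat.mod_lt _ hm) (Nat.mod_lt _ hm) h
    have h2 : i ≡ j [MOD m] := Nat.ModEq.add_right_cancel' _ h1
    unfold Nat.ModEq at h2
    rwa [Nat.mod_eq_of_lt hi, Nat.mod_eq_of_lt hj] at h2
  · intro i
    set c := m * a - a
    have e : i + 1 + c = i + c + 1 := by omega
    simp only [e]
    have hlt := Nat.mod_lt (i + c) hm
    by_cases h : (i + c) % m + 1 < m
    · have : (i + c + 1) % m = (i + c) % m + 1 := by
        rw [← Nat.mod_add_mod, Nat.mod_eq_of_lt h]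
      rw [this]; exact hstep _ h
    · have h' : (i + c) % m = m - 1 := by omega
      have : (i + c + 1) % m = 0 := by
        rw [← Nat.mod_add_mod, h', Nat.sub_add_cancel hm, Nat.mod_self]
      rw [this, h']; exact hlast
  · intro r hr
    have h1 : a ≤ m * a := Nat.le_mul_of_pos_left a hm
    have : a + r + (m * a - a) = r + m * a := by omega
    simp only [this, Nat.add_mul_mod_self_left, Nat.mod_eq_of_lt hr]

lemma escher_mod {U : Finset ℝ} {m : ℕ} {w : ℕ → ℝ} (h : IsEscher U m w) (i : ℕ) :
    w (i % m) = w i :=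
  (show Function.Periodic w m from h.1).map_mod_nat i

lemma escher_window_inj {U : Finset ℝ} {m : ℕ} (hm : 0 < m) {w : ℕ → ℝ} (h : IsEscher U m w)
    (a r s : ℕ) (hr : r < m) (hs : s < m) (e : w (a + r) = w (a + s)) : r = s := by
  rw [← escher_mod h (a + r), ← escher_mod h (a + s)] at e
  have h1 := h.2.2.1 _ _ (Nat.mod_lt _ hm) (Nat.mod_lt _ hm) e
  have h2 : r ≡ s [MOD m] := Nat.ModEq.add_left_cancel' a h1
  unfold Nat.ModEq at h2
  rwa [Nat.mod_eq_of_lt hr, Nat.mod_eq_of_lt hs] at h2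

lemma escher_ext {U : Finset ℝ} {m : ℕ} (hm : 0 < m) {w w' : ℕ → ℝ} (h : IsEscher U m w)
    (h' : IsEscher U m w') (a : ℕ) (e : ∀ r, r < m → w (a + r) = w' (a + r)) : w = w' := by
  have key : ∀ d, w (a + d) = w' (a + d) := by
    intro d
    induction d using Nat.strong_induction_on with
    | _ d ih =>
      by_cases hd : d < m
      · exact e d hd
      · have h1 := ih (d - m) (by omega)
        have h2 := h.1 (a + (d - m))
        have h3 := h'.1 (a + (d - m))
        rw [show a + (d - m) + m = a + d by omega] at h2 h3
        rw [h2, h3, h1]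
  funext i
  have p1 := (show Function.Periodic w m from h.1).nat_mul a i
  have p2 := (show Function.Periodic w' m from h'.1).nat_mul a i
  have h1 : a ≤ a * m := Nat.le_mul_of_pos_right a hm
  have h2 := key (i + a * m - a)
  rw [show a + (i + a * m - a) = i + a * m by omega] at h2
  simp only [Nat.cast_id] at p1 p2
  rw [← p1, ← p2, h2]

/-- Position `i` is a valid place to cut out a `k`-subEscher. -/
def EscherCut (k : ℕ) (w : ℕ → ℝ) (i : ℕ) : Prop :=
  w (i + k) < w (i + 1) + 1 ∧ w i < w (i + k + 1) + 1

lemma escher_types (k : ℕ) (w : ℕ → ℝ) (hw : ∀ i, w i < w (i + 1) + 1) (i : ℕ)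
    (h : ∀ j, j < i → ¬ EscherCut k w j) :
    (∀ j, j < i → w (j + 1) + 1 ≤ w (j + k)) ∨ (∀ j, j < i → w (j + k + 1) + 1 ≤ w j) := by
  induction i with
  | zero => left; intro j hj; omega
  | succ i ih =>
    have hb : w (i + 1) + 1 ≤ w (i + k) ∨ w (i + k + 1) + 1 ≤ w i := by
      have := h i (by omega)
      unfold EscherCut at this
      by_contra hc
      push Not at hc
      exact this hc
    rcases Nat.eq_zero_or_pos i with h0 | h0
    · subst h0
      rcases hb with hb | hb
      · left; intro j hj
        obtain rfl : j = 0 := by omega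
        exact hb
      · right; intro j hj
        obtain rfl : j = 0 := by omega
        exact hb
    · obtain ⟨p, rfl⟩ : ∃ p, i = p + 1 := ⟨i - 1, by omega⟩
      have e : p + 1 + k = p + k + 1 := by omega
      have a1 := hw (p + k)
      have a2 := hw p
      have a3 := hw (p + 1)
      have a4 := hw (p + 1 + k)
      rw [e] at hb a4
      rcases ih (fun j hj => h j (by omega)) with ih | ih
      · left; intro j hj
        rcases Nat.lt_succ_iff_lt_or_eq.1 hj with hj | rfl
        · exact ih j hj
        · have := ih p (by omega)
          rw [e]
          rcases hb with hb | hb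
          · exact hb
          · linarith
      · right; intro j hj
        rcases Nat.lt_succ_iff_lt_or_eq.1 hj with hj | rfl
        · exact ih j hj
        · have := ih p (by omega)
          rw [e]
          rcases hb with hb | hb
          · linarith
          · exact hb

lemma escher_cut_exists {U : Finset ℝ} {n k : ℕ} (hN : 0 < n + k) {w : ℕ → ℝ}
    (h : IsEscher U (n + k) w) : ∃ i, EscherCut k w i := by
  by_contra hc
  push Not at hc
  have hw := h.2.2.2
  have per : w (k * (n + k)) = w 0 := by
    have := (show Function.Periodic w (n + k) from h.1).nat_mul k 0
    simpa using this
  have ty := escher_types k w hw (k * (n + k) + k + 1) (fun j _ => hc j)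
  rcases ty with ty | ty
  · have key : ∀ t, t < n + k → w 0 < w (k * (t + 1)) := by
      intro t
      induction t with
      | zero =>
        intro _
        have b1 := ty 0 (by omega)
        have b2 := hw 0
        simp only [Nat.zero_add, Nat.mul_one] at *
        linarith
      | succ t ih =>
        intro ht
        have b0 := ih (by omega)
        have hle : k * (t + 1) ≤ k * (n + k) := Nat.mul_le_mul_left _ (by omega)
        have b1 := ty (k * (t + 1)) (by omega)
        have b2 := hw (k * (t + 1))
        rw [show k * (t + 1) + k = k * (t + 1 + 1) by ring] at b1
        linarith
    have := key (n + k - 1) (by omega)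
    rw [Nat.sub_add_cancel hN, per] at this
    exact lt_irrefl _ this
  · have key : ∀ t, t < n + k → w (k * (t + 1)) < w 0 := by
      intro t
      induction t with
      | zero =>
        intro _
        have b1 := ty 0 (by omega)
        have b2 := hw k
        simp only [Nat.zero_add, Nat.mul_one] at *
        linarith
      | succ t ih =>
        intro ht
        have b0 := ih (by omega)
        have hle : k * (t + 1) ≤ k * (n + k) := Nat.mul_le_mul_left _ (by omega)
        have b1 := ty (k * (t + 1)) (by omega)
        have b2 := hw (k * (t + 1) + k)
        rw [show k * (t + 1 + 1) = k * (t + 1) + k by ring]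
        linarith
    have := key (n + k - 1) (by omega)
    rw [Nat.sub_add_cancel hN, per] at this
    exact lt_irrefl _ this

/-- `(u, v)` is the splitting of `w` at its first valid cut `i`. -/
def EscherSplit (U : Finset ℝ) (n k : ℕ) (w u v : ℕ → ℝ) (i : ℕ) : Prop :=
  IsEscher U n u ∧ IsEscher U k v ∧ EscherCut k w i ∧ (∀ j, j < i → ¬ EscherCut k w j) ∧
  (∀ r, r < n → u (i + 1 + r) = w (i + 1 + k + r)) ∧ (∀ r, r < k → v (i + 1 + r) = w (i + 1 + r))

lemma escher_split_exists {U : Finset ℝ} {n k : ℕ} (hn : 0 < n) (hk : 0 < k) {w : ℕ → ℝ}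
    (h : IsEscher U (n + k) w) : ∃ u v i, EscherSplit U n k w u v i := by
  classical
  have hex := escher_cut_exists (by omega) h
  obtain ⟨i, hi, hmin⟩ : ∃ i, EscherCut k w i ∧ ∀ j, j < i → ¬ EscherCut k w j :=
    ⟨Nat.find hex, Nat.find_spec hex, fun j hj => Nat.find_min hex hj⟩
  obtain ⟨u, hu, hu'⟩ := escher_wrap U n (i + 1) hn (fun r => w (i + 1 + k + r))
    (fun r => h.2.1 _)
    (fun r s hr hs e => escher_window_inj (by omega) h (i + 1 + k) r s (by omega) (by omega) e)
    (fun r _ => h.2.2.2 (i + 1 + k + r))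
    (by
      have h1 := hi.2
      have h2 := h.1 i
      show w (i + 1 + k + (n - 1)) < w (i + 1 + k + 0) + 1
      rw [show i + 1 + k + (n - 1) = i + (n + k) by omega, h2,
        show i + 1 + k + 0 = i + k + 1 by omega]
      exact h1)
  obtain ⟨v, hv, hv'⟩ := escher_wrap U k (i + 1) hk (fun r => w (i + 1 + r))
    (fun r => h.2.1 _)
    (fun r s hr hs e => escher_window_inj (by omega) h (i + 1) r s (by omega) (by omega) e)
    (fun r _ => h.2.2.2 (i + 1 + r))
    (by
      have h1 := hi.1
      show w (i + 1 + (k - 1)) < w (i + 1 + 0) + 1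
      rw [show i + 1 + (k - 1) = i + k by omega]
      exact h1)
  refine ⟨u, v, i, ?_⟩
  exact And.intro hu (And.intro hv (And.intro hi (And.intro hmin (And.intro hu' (fun r hr => hv' r hr)))))

/-- Position `j` is a valid insertion for `(u, v)`. -/
def EscherIns (u v : ℕ → ℝ) (j : ℕ) : Prop := u j < v (j + 1) + 1 ∧ v j < u (j + 1) + 1

lemma escher_split_near {U : Finset ℝ} {n k : ℕ} {w u v : ℕ → ℝ} {i : ℕ}
    (h : IsEscher U (n + k) w) (hs : EscherSplit U n k w u v i) :
    (∀ m, m ≤ i → i < m + n → u m = w m) ∧ (∀ m, m ≤ i → i < m + k → v m = w (m + k)) := by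
  obtain ⟨hu, hv, -, -, hu', hv'⟩ := hs
  constructor
  · intro m h1 h2
    have := hu' (m + n - (i + 1)) (by omega)
    rw [show i + 1 + (m + n - (i + 1)) = m + n by omega, hu.1,
      show i + 1 + k + (m + n - (i + 1)) = m + (n + k) by omega, h.1] at this
    exact this
  · intro m h1 h2
    have := hv' (m + k - (i + 1)) (by omega)
    rw [show i + 1 + (m + k - (i + 1)) = m + k by omega, hv.1] at this
    exact this

lemma escher_split_ins {U : Finset ℝ} {n k : ℕ} (hn : 0 < n) (hk : 0 < k) {w u v : ℕ → ℝ} {i : ℕ}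
    (h : IsEscher U (n + k) w) (hs : EscherSplit U n k w u v i) : EscherIns u v i := by
  obtain ⟨n1, n2⟩ := escher_split_near h hs
  have e1 := n1 i le_rfl (by omega)
  have e2 := n2 i le_rfl (by omega)
  have e3 := hs.2.2.2.2.1 0 hn
  have e4 := hs.2.2.2.2.2 0 hk
  simp only [Nat.add_zero] at e3 e4
  refine ⟨?_, ?_⟩
  · rw [e1, e4]; exact h.2.2.2 i
  · rw [e2, e3, show i + 1 + k = i + k + 1 by omega]; exact h.2.2.2 (i + k)

lemma escher_split_not_ins {U : Finset ℝ} {n k : ℕ} (hn : 0 < n) (hk : 0 < k) {w u v : ℕ → ℝ}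
    {i : ℕ} (h : IsEscher U (n + k) w) (hs : EscherSplit U n k w u v i) (j : ℕ) (hj : j < i) :
    ¬ EscherIns u v j := by
  obtain ⟨n1, n2⟩ := escher_split_near h hs
  have hw := h.2.2.2
  have hu := hs.1
  have hv := hs.2.1
  rintro ⟨i1, i2⟩
  rcases escher_types k w hw i hs.2.2.2.1 with ty | ty
  · have up : ∀ m, m ≤ i → w m < w (m + k) := by
      intro m hm
      rcases Nat.lt_or_ge m i with hm' | hm'
      · have := ty m hm'
        have := hw m
        linarith
      · obtain ⟨p, rfl⟩ : ∃ p, m = p + 1 := ⟨m - 1, by omega⟩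
        have b1 := ty p (by omega)
        have b2 := hw (p + k)
        rw [show p + 1 + k = p + k + 1 by omega]
        linarith
    have ku : ∀ d m, m + d = i → u m ≤ w m := by
      intro d
      induction d using Nat.strong_induction_on with
      | _ d ih =>
        intro m hm
        by_cases hd : d < n
        · exact (n1 m (by omega) (by omega)).le
        · have b1 := ih (d - n) (by omega) (m + n) (by omega)
          have b2 := up (m + n) (by omega)
          rw [hu.1] at b1
          rw [show m + n + k = m + (n + k) by omega, h.1] at b2
          linarith
    have kv : ∀ d m, m + d = i → w (m + k) ≤ v m := by
      intro d
      induction d using Nat.strong_induction_on with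
      | _ d ih =>
        intro m hm
        by_cases hd : d < k
        · exact (n2 m (by omega) (by omega)).ge
        · have b1 := ih (d - k) (by omega) (m + k) (by omega)
          have b2 := up (m + k) (by omega)
          rw [hv.1] at b1
          linarith
    have c1 := ku (i - (j + 1)) (j + 1) (by omega)
    have c2 := kv (i - j) j (by omega)
    have c3 := ty j hj
    linarith
  · have dn : ∀ m, m ≤ i → w (m + k) < w m := by
      intro m hm
      rcases Nat.lt_or_ge m i with hm' | hm'
      · have := ty m hm'
        have := hw (m + k)
        linarith
      · obtain ⟨p, rfl⟩ : ∃ p, m = p + 1 := ⟨m - 1, by omega⟩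
        have b1 := ty p (by omega)
        have b2 := hw p
        rw [show p + 1 + k = p + k + 1 by omega]
        linarith
    have ku : ∀ d m, m + d = i → w m ≤ u m := by
      intro d
      induction d using Nat.strong_induction_on with
      | _ d ih =>
        intro m hm
        by_cases hd : d < n
        · exact (n1 m (by omega) (by omega)).ge
        · have b1 := ih (d - n) (by omega) (m + n) (by omega)
          have b2 := dn (m + n) (by omega)
          rw [hu.1] at b1
          rw [show m + n + k = m + (n + k) by omega, h.1] at b2
          linarith
    have kv : ∀ d m, m + d = i → v m ≤ w (m + k) := by
      intro d
      induction d using Nat.strong_induction_on with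
      | _ d ih =>
        intro m hm
        by_cases hd : d < k
        · exact (n2 m (by omega) (by omega)).le
        · have b1 := ih (d - k) (by omega) (m + k) (by omega)
          have b2 := dn (m + k) (by omega)
          rw [hv.1] at b1
          linarith
    have c1 := ku (i - j) j (by omega)
    have c2 := kv (i - (j + 1)) (j + 1) (by omega)
    have c3 := ty j hj
    rw [show j + 1 + k = j + k + 1 by omega] at c2
    linarith

lemma escher_split_inj {U : Finset ℝ} {n k : ℕ} (hn : 0 < n) (hk : 0 < k) {w w' u v : ℕ → ℝ}
    {i i' : ℕ} (h : IsEscher U (n + k) w) (h' : IsEscher U (n + k) w')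
    (hs : EscherSplit U n k w u v i) (hs' : EscherSplit U n k w' u v i') : w = w' := by
  have hi : i = i' := by
    rcases lt_trichotomy i i' with hl | hl | hl
    · exact absurd (escher_split_ins hn hk h hs) (escher_split_not_ins hn hk h' hs' i hl)
    · exact hl
    · exact absurd (escher_split_ins hn hk h' hs') (escher_split_not_ins hn hk h hs i' hl)
  subst hi
  refine escher_ext (by omega) h h' (i + 1) ?_
  intro r hr
  by_cases hrk : r < k
  · rw [← hs.2.2.2.2.2 r hrk, ← hs'.2.2.2.2.2 r hrk]
  · have e1 := hs.2.2.2.2.1 (r - k) (by omega)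
    have e2 := hs'.2.2.2.2.1 (r - k) (by omega)
    rw [show i + 1 + k + (r - k) = i + 1 + r by omega] at e1 e2
    rw [← e1, ← e2]

lemma escher_finite (U : Finset ℝ) (m : ℕ) (hm : 0 < m) :
    {w : ℕ → ℝ | IsEscher U m w}.Finite := by
  refine Set.Finite.of_finite_image (f := fun w => fun r : Fin m => w r) ?_ ?_
  · refine (Set.Finite.pi' (t := fun _ : Fin m => (U : Set ℝ)) (fun _ => U.finite_toSet)).subset ?_
    rintro _ ⟨w, hw, rfl⟩ r
    exact hw.2.1 _
  · intro w hw w' hw' e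
    refine escher_ext hm hw hw' 0 ?_
    intro r hr
    rw [Nat.zero_add]
    exact congrFun e ⟨r, hr⟩

/-- For `n > k ≥ 1` coprime and a UIO `U` with `n + k` elements, the number of
`(n+k)`-Eschers in `U` is at most the product of the numbers of `n`-Eschers and of
`k`-Eschers: `#P_{n+k} ≤ #P_n · #P_k`. -/
theorem escher_count_ineq (U : Finset ℝ) (n k : ℕ) (hk : 1 ≤ k) (hnk : k < n)
    (hcop : Nat.gcd n k = 1) (hcard : U.card = n + k) :
    {w : ℕ → ℝ | IsEscher U (n + k) w}.ncard ≤
      {w : ℕ → ℝ | IsEscher U n w}.ncard * {w : ℕ → ℝ | IsEscher U k w}.ncard := by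
  have hn : 0 < n := by omega
  have hex : ∀ w : ℕ → ℝ, ∃ p : (ℕ → ℝ) × (ℕ → ℝ), IsEscher U (n + k) w →
      ∃ i, EscherSplit U n k w p.1 p.2 i := by
    intro w
    by_cases h : IsEscher U (n + k) w
    · obtain ⟨u, v, i, hs⟩ := escher_split_exists hn hk h
      exact ⟨(u, v), fun _ => ⟨i, hs⟩⟩
    · exact ⟨(w, w), fun h' => absurd h' h⟩
  choose f hf using hex
  rw [← Set.ncard_prod]
  refine Set.ncard_le_ncard_of_injOn f ?_ ?_ ?_
  · intro w hw
    obtain ⟨i, hs⟩ := hf w hw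
    exact ⟨hs.1, hs.2.1⟩
  · intro w hw w' hw' e
    obtain ⟨i, hs⟩ := hf w hw
    obtain ⟨i', hs'⟩ := hf w' hw'
    rw [← e] at hs'
    exact escher_split_inj hn hk hw hw' hs hs'
  · exact (escher_finite U n hn).prod (escher_finite U k hk)
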